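/- arXiv:math/0311442 — 2 statements merged into one kernel-verified Lean document; each statement's English description precedes it below -/
import Mathlib

section
/- Let n ≥ 1 and let Λ, Λ' ∈ M_n(k*) be multiplicatively antisymmetric. Let A and B be k-algebras such that O_Λ((k*)^n) is a maximal quantum subtorus of A and O_{Λ'}((k*)^n) is a maximal quantum subtorus of B. If A and B are isomorphic as k-algebras and O_Λ((k*)^n) is a simple ring, then O_Λ((k*)^n) and O_{Λ'}((k*)^n) are isomorphic as k-algebras. -/
universe u

/-- A matrix is multiplicatively antisymmetric if `Λ i i = 1` and `Λ i j * Λ j i = 1`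
for all `i, j`. -/
def Matrix.MulAntisymmetric {k : Type u} [Field k] {n : ℕ}
    (Λ : Matrix (Fin n) (Fin n) k) : Prop :=
  (∀ i, Λ i i = 1) ∧ ∀ i j, Λ i j * Λ j i = 1

inductive QTorusRel (k : Type u) [Field k] {n : ℕ} (Λ : Matrix (Fin n) (Fin n) k) :
    FreeAlgebra k (Fin n ⊕ Fin n) → FreeAlgebra k (Fin n ⊕ Fin n) → Prop
  | comm (i j : Fin n) :
      QTorusRel k Λ (FreeAlgebra.ι k (Sum.inl i) * FreeAlgebra.ι k (Sum.inl j))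
        (algebraMap k _ (Λ i j) * (FreeAlgebra.ι k (Sum.inl j) * FreeAlgebra.ι k (Sum.inl i)))
  | mul_inv (i : Fin n) :
      QTorusRel k Λ (FreeAlgebra.ι k (Sum.inl i) * FreeAlgebra.ι k (Sum.inr i)) 1
  | inv_mul (i : Fin n) :
      QTorusRel k Λ (FreeAlgebra.ι k (Sum.inr i) * FreeAlgebra.ι k (Sum.inl i)) 1

/-- The quantum torus `O_Λ((k*)^n)`. -/
def QuantumTorus (k : Type u) [Field k] {n : ℕ} (Λ : Matrix (Fin n) (Fin n) k) :=
  RingQuot (QTorusRel k Λ)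

noncomputable instance (k : Type u) [Field k] {n : ℕ} (Λ : Matrix (Fin n) (Fin n) k) :
    Ring (QuantumTorus k Λ) := by unfold QuantumTorus; infer_instance

noncomputable instance (k : Type u) [Field k] {n : ℕ} (Λ : Matrix (Fin n) (Fin n) k) :
    Algebra k (QuantumTorus k Λ) := by unfold QuantumTorus; infer_instance

/-- The generator `y_i` of the quantum torus. -/
noncomputable def QuantumTorus.y (k : Type u) [Field k] {n : ℕ}
    (Λ : Matrix (Fin n) (Fin n) k) (i : Fin n) : QuantumTorus k Λ :=
  RingQuot.mkAlgHom k (QTorusRel k Λ) (FreeAlgebra.ι k (Sum.inl i))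

/-- The generator `y_i⁻¹` of the quantum torus. -/
noncomputable def QuantumTorus.yinv (k : Type u) [Field k] {n : ℕ}
    (Λ : Matrix (Fin n) (Fin n) k) (i : Fin n) : QuantumTorus k Λ :=
  RingQuot.mkAlgHom k (QTorusRel k Λ) (FreeAlgebra.ι k (Sum.inr i))


/-- `O_Λ((k*)^n)` is a maximal quantum subtorus of the `k`-algebra `A` if it embeds
into `A` and every quantum torus admitting a homomorphic image in `A` admits a
homomorphic image in `O_Λ((k*)^n)`. -/
def IsMaxQuantumSubtorus (k : Type u) [Field k] {n : ℕ} (Λ : Matrix (Fin n) (Fin n) k)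
    (A : Type u) [Ring A] [Algebra k A] : Prop :=
  (∃ f : QuantumTorus k Λ →ₐ[k] A, Function.Injective f) ∧
  ∀ (m : ℕ), 1 ≤ m → ∀ M : Matrix (Fin m) (Fin m) k, M.MulAntisymmetric →
    Nonempty (QuantumTorus k M →ₐ[k] A) →
    Nonempty (QuantumTorus k M →ₐ[k] QuantumTorus k Λ)

open scoped MonoidAlgebra

section UnitsModScalars

variable (k : Type*) [Field k] (R : Type*) [Ring R] [Algebra k R]

/-- The central subgroup `kˣ` of the unit group of a `k`-algebra. -/
def scalarUnits : Subgroup Rˣ := (Units.map (algebraMap k R : k →* R)).range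

variable {k R}

theorem mem_scalarUnits {a : Rˣ} :
    a ∈ scalarUnits k R ↔ ∃ c : kˣ, (a : R) = (c : k) • (1 : R) := by
  simp only [scalarUnits, MonoidHom.mem_range]
  refine exists_congr fun c ↦ ?_
  rw [← Algebra.algebraMap_eq_smul_one, Units.ext_iff, eq_comm]
  rfl

instance : (scalarUnits k R).Normal where
  conj_mem a ha g := by
    obtain ⟨c, hc⟩ := mem_scalarUnits.1 ha
    exact mem_scalarUnits.2 ⟨c, by simp [hc]⟩

variable (k R) in
/-- The unit group of a `k`-algebra modulo its scalars. -/
abbrev UnitsModScalars := Rˣ ⧸ scalarUnits k R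

variable (k) in
/-- The class of a unit modulo scalars. -/
abbrev unitClass : Rˣ →* UnitsModScalars k R := QuotientGroup.mk' (scalarUnits k R)

theorem unitClass_surjective : Function.Surjective (unitClass k (R := R)) :=
  QuotientGroup.mk'_surjective _

theorem unitClass_eq_iff {a b : Rˣ} :
    unitClass k a = unitClass k b ↔ ∃ c : kˣ, (b : R) = (c : k) • (a : R) := by
  rw [QuotientGroup.mk'_apply, QuotientGroup.mk'_apply, QuotientGroup.eq, mem_scalarUnits]
  refine exists_congr fun c ↦ ?_
  rw [Units.val_mul, Units.inv_mul_eq_iff_eq_mul, mul_smul_comm, mul_one]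

/-- A `k`-algebra homomorphism acts on units modulo scalars. -/
def UnitsModScalars.map {S : Type*} [Ring S] [Algebra k S] (f : R →ₐ[k] S) :
    UnitsModScalars k R →* UnitsModScalars k S :=
  QuotientGroup.map _ _ (Units.map (f : R →* S)) fun a ha ↦ by
    obtain ⟨c, hc⟩ := mem_scalarUnits.1 ha
    exact mem_scalarUnits.2 ⟨c, by simp [hc]⟩

theorem UnitsModScalars.map_unitClass {S : Type*} [Ring S] [Algebra k S] (f : R →ₐ[k] S)
    (a : Rˣ) : map f (unitClass k a) = unitClass k (Units.map (f : R →* S) a) :=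
  rfl

/-- If units commute up to scalars, the scalars only depend on the classes of the units. -/
theorem exists_commutator_pairing
    (hcomm : ∀ x y : UnitsModScalars k R, x * y = y * x) :
    ∃ β : UnitsModScalars k R → UnitsModScalars k R → kˣ,
      ∀ a b : Rˣ, (a : R) * b = (β (unitClass k a) (unitClass k b) : k) • ((b : R) * a) := by
  have key : ∀ a b : Rˣ, ∃ c : kˣ, (a : R) * b = (c : k) • ((b : R) * a) := fun a b ↦ by
    have h := hcomm (unitClass k b) (unitClass k a)
    rw [← map_mul, ← map_mul, unitClass_eq_iff] at h
    simpa using h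
  choose β hβ using key
  choose s hs using unitClass_surjective (k := k) (R := R)
  refine ⟨fun x y ↦ β (s x) (s y), fun a b ↦ ?_⟩
  obtain ⟨c, hc⟩ := unitClass_eq_iff.1 (hs (unitClass k a))
  obtain ⟨d, hd⟩ := unitClass_eq_iff.1 (hs (unitClass k b))
  simp only [hc, hd, smul_mul_assoc, mul_smul_comm]
  rw [hβ (s (unitClass k a))]
  simp only [smul_smul]
  congr 1
  ring

theorem smul_unit_injective [Nontrivial R] (a : Rˣ) :
    Function.Injective fun c : k ↦ c • (a : R) :=
  smul_left_injective k a.ne_zero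

end UnitsModScalars

/-- A surjectivity criterion: an endomorphism preserving a nondegenerate biadditive pairing on a
finitely generated abelian group is surjective. -/
theorem surjective_of_preserves_pairing {M G : Type*} [AddCommGroup M] [Module.Finite ℤ M]
    [AddCommGroup G] (β : M →+ M →+ G) (hβ : ∀ v, (∀ u, β u v = 0) → v = 0)
    (C : M →ₗ[ℤ] M) (hC : ∀ u v, β (C u) (C v) = β u v) : Function.Surjective C := by
  obtain ⟨p, hp, h0⟩ := LinearMap.exists_monic_and_aeval_eq_zero ℤ C
  have hpow : ∀ (i : ℕ) (u v : M), β ((C ^ i) u) ((C ^ i) v) = β u v := by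
    intro i
    induction i with
    | zero => simp
    | succ i ih =>
      intro u v
      rw [pow_succ', Module.End.mul_apply, Module.End.mul_apply, hC, ih]
  intro v
  have hv : ∑ i ∈ Finset.range (p.natDegree + 1), p.coeff i • (C ^ (p.natDegree - i)) v = 0 := by
    refine hβ _ fun u ↦ ?_
    calc _ = ∑ i ∈ Finset.range (p.natDegree + 1),
          p.coeff i • β ((C ^ i) u) ((C ^ p.natDegree) v) := by
          rw [map_sum]
          refine Finset.sum_congr rfl fun i hi ↦ ?_
          have hi' : i + (p.natDegree - i) = p.natDegree := by
            have := Finset.mem_range.1 hi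
            omega
          rw [map_zsmul, ← hpow i, ← Module.End.mul_apply, ← pow_add, hi']
      _ = β (Polynomial.aeval C p u) ((C ^ p.natDegree) v) := by
          rw [Polynomial.aeval_eq_sum_range, LinearMap.sum_apply, map_sum,
            AddMonoidHom.finsetSum_apply]
          simp
      _ = 0 := by rw [h0]; simp
  rw [Finset.sum_range_succ, hp.coeff_natDegree, Nat.sub_self, pow_zero, one_smul,
    Module.End.one_apply] at hv
  rw [eq_neg_of_add_eq_zero_right hv]
  refine (LinearMap.mem_range (f := C)).1 (neg_mem (sum_mem fun i hi ↦ ?_))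
  refine Submodule.smul_mem _ _ ⟨(C ^ (p.natDegree - i - 1)) v, ?_⟩
  rw [← Module.End.mul_apply, ← pow_succ']
  congr 2
  have := Finset.mem_range.1 hi
  omega

namespace QuantumTorus

variable {k : Type u} [Field k] {n : ℕ} {Λ : Matrix (Fin n) (Fin n) k}

variable (k Λ) in
/-- The quotient map from the free algebra. -/
noncomputable def mk : FreeAlgebra k (Fin n ⊕ Fin n) →ₐ[k] QuantumTorus k Λ :=
  RingQuot.mkAlgHom k (QTorusRel k Λ)

theorem mk_surjective : Function.Surjective (mk k Λ) :=
  RingQuot.mkAlgHom_surjective k (QTorusRel k Λ)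

theorem mk_eq_of_rel {a b : FreeAlgebra k (Fin n ⊕ Fin n)} (h : QTorusRel k Λ a b) :
    mk k Λ a = mk k Λ b :=
  RingQuot.mkAlgHom_rel k h

theorem mk_inl (i : Fin n) : mk k Λ (FreeAlgebra.ι k (Sum.inl i)) = y k Λ i := rfl

theorem mk_inr (i : Fin n) : mk k Λ (FreeAlgebra.ι k (Sum.inr i)) = yinv k Λ i := rfl

theorem y_mul_y (i j : Fin n) : y k Λ i * y k Λ j = Λ i j • (y k Λ j * y k Λ i) := by
  simpa [mk_inl, Algebra.smul_def] using mk_eq_of_rel (QTorusRel.comm (Λ := Λ) i j)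

variable (k Λ) in
/-- The generator `y_i` as a unit. -/
noncomputable def unitY (i : Fin n) : (QuantumTorus k Λ)ˣ where
  val := y k Λ i
  inv := yinv k Λ i
  val_inv := by simpa [mk_inl, mk_inr] using mk_eq_of_rel (QTorusRel.mul_inv (Λ := Λ) i)
  inv_val := by simpa [mk_inl, mk_inr] using mk_eq_of_rel (QTorusRel.inv_mul (Λ := Λ) i)

theorem subalgebra_eq_top (S : Subalgebra k (QuantumTorus k Λ))
    (hy : ∀ i, y k Λ i ∈ S) (hyinv : ∀ i, yinv k Λ i ∈ S) : S = ⊤ := by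
  refine eq_top_iff.2 fun x _ ↦ ?_
  obtain ⟨x, rfl⟩ := mk_surjective x
  induction x using FreeAlgebra.induction with
  | grade0 r => rw [AlgHom.commutes]; exact S.algebraMap_mem r
  | grade1 i =>
    cases i with
    | inl i => exact hy i
    | inr i => exact hyinv i
  | mul a b ha hb => rw [map_mul]; exact S.mul_mem (ha trivial) (hb trivial)
  | add a b ha hb => rw [map_add]; exact S.add_mem (ha trivial) (hb trivial)

/-- The group of exponents of Laurent monomials, written multiplicatively. -/
abbrev Exponent (n : ℕ) := Fin n → Multiplicative ℤ

/-- The exponent of the generator `y_i`. -/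
def basisExponent (i : Fin n) : Exponent n := Pi.mulSingle i (Multiplicative.ofAdd 1)

variable (Λ) in
/-- The coaction of the torus, i.e. the `ℤⁿ`-grading in which `y_i` has degree `e_i`. -/
noncomputable def coaction : QuantumTorus k Λ →ₐ[k] (QuantumTorus k Λ)[Exponent n] :=
  RingQuot.liftAlgHom k ⟨FreeAlgebra.lift k (Sum.elim
      (fun i ↦ MonoidAlgebra.single (basisExponent i) (y k Λ i))
      (fun i ↦ MonoidAlgebra.single (basisExponent i)⁻¹ (yinv k Λ i))), by
    intro a b h
    induction h with
    | comm i j =>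
      simp [y_mul_y i j, mul_comm (basisExponent i), ← Algebra.smul_def]
    | mul_inv i =>
      simp [MonoidAlgebra.one_def, show y k Λ i * yinv k Λ i = 1 from (unitY k Λ i).mul_inv]
    | inv_mul i =>
      simp [MonoidAlgebra.one_def, show yinv k Λ i * y k Λ i = 1 from (unitY k Λ i).inv_mul]⟩

theorem coaction_y (i : Fin n) :
    coaction Λ (y k Λ i) = MonoidAlgebra.single (basisExponent i) (y k Λ i) := by
  have h : coaction Λ (mk k Λ (FreeAlgebra.ι k (Sum.inl i))) =
      FreeAlgebra.lift k (Sum.elim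
      (fun i ↦ MonoidAlgebra.single (basisExponent i) (y k Λ i))
      (fun i ↦ MonoidAlgebra.single (basisExponent i)⁻¹ (yinv k Λ i)))
      (FreeAlgebra.ι k (Sum.inl i)) :=
    RingQuot.liftAlgHom_mkAlgHom_apply ..
  simpa [mk_inl] using h

theorem commute_unitClass_unitY (hΛ : Λ.MulAntisymmetric) (i j : Fin n) :
    Commute (unitClass k (unitY k Λ i)) (unitClass k (unitY k Λ j)) := by
  refine Eq.symm ?_
  rw [← map_mul, ← map_mul, unitClass_eq_iff]
  exact ⟨Units.mk0 (Λ i j) (left_ne_zero_of_mul_eq_one (hΛ.2 i j)), y_mul_y i j⟩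

/-- The homomorphism sending an exponent `v` to the class of the Laurent monomial `y^v`. -/
noncomputable def monomialClass (hΛ : Λ.MulAntisymmetric) :
    Exponent n →* UnitsModScalars k (QuantumTorus k Λ) :=
  MonoidHom.noncommPiCoprod (fun i ↦ zpowersHom _ (unitClass k (unitY k Λ i)))
    fun i j _ a b ↦ by
      simpa using (commute_unitClass_unitY hΛ i j).zpow_zpow _ _

theorem monomialClass_basisExponent (hΛ : Λ.MulAntisymmetric) (i : Fin n) :
    monomialClass hΛ (basisExponent i) = unitClass k (unitY k Λ i) := by
  simp [monomialClass, basisExponent]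

theorem subgroup_eq_top_of_basisExponent_mem (H : Subgroup (Exponent n))
    (h : ∀ i, basisExponent i ∈ H) (v : Exponent n) : v ∈ H := by
  refine Subgroup.pi_mem_of_mulSingle_mem v fun i ↦ ?_
  convert H.zpow_mem (h i) (v i).toAdd
  rw [basisExponent, ← Pi.mulSingle_zpow, ← ofAdd_zsmul]
  simp

/-- A unit whose class is that of a monomial is homogeneous. -/
theorem coaction_of_unitClass_eq (hΛ : Λ.MulAntisymmetric) (v : Exponent n) :
    ∀ a : (QuantumTorus k Λ)ˣ, unitClass k a = monomialClass hΛ v →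
      coaction Λ (a : QuantumTorus k Λ) = MonoidAlgebra.single v (a : QuantumTorus k Λ) := by
  let H : Subgroup (Exponent n) :=
    { carrier := {v | ∀ a : (QuantumTorus k Λ)ˣ, unitClass k a = monomialClass hΛ v →
        coaction Λ (a : QuantumTorus k Λ) = MonoidAlgebra.single v (a : QuantumTorus k Λ)}
      one_mem' := fun a ha ↦ by
        rw [map_one, ← map_one (unitClass k), eq_comm, unitClass_eq_iff] at ha
        obtain ⟨c, hc⟩ := ha
        rw [hc, map_smul, Units.val_one, map_one, MonoidAlgebra.one_def, MonoidAlgebra.smul_single]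
      mul_mem' := fun {v w} hv hw a ha ↦ by
        obtain ⟨b, hb⟩ := unitClass_surjective (monomialClass hΛ v)
        have h := hw (b⁻¹ * a) (by rw [map_mul, map_inv, hb, ha, map_mul, inv_mul_cancel_left])
        have h' := congrArg₂ (· * ·) (hv b hb) h
        simpa [← map_mul, MonoidAlgebra.single_mul_single] using h'
      inv_mem' := fun {v} hv a ha ↦ by
        have h := hv a⁻¹ (by rw [map_inv, ha, map_inv, inv_inv])
        refine left_inv_eq_right_inv (a := coaction Λ (↑a⁻¹ : QuantumTorus k Λ)) ?_ ?_
        · rw [← map_mul, Units.mul_inv, map_one]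
        · rw [h, MonoidAlgebra.single_mul_single, Units.inv_mul, mul_inv_cancel,
            MonoidAlgebra.one_def] }
  refine subgroup_eq_top_of_basisExponent_mem H (fun i a ha ↦ ?_) v
  rw [monomialClass_basisExponent, eq_comm, unitClass_eq_iff] at ha
  obtain ⟨c, hc⟩ := ha
  have : ((unitY k Λ i : (QuantumTorus k Λ)ˣ) : QuantumTorus k Λ) = y k Λ i := rfl
  rw [hc, map_smul, this, coaction_y, MonoidAlgebra.smul_single]

theorem monomialClass_injective [Nontrivial (QuantumTorus k Λ)] (hΛ : Λ.MulAntisymmetric) :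
    Function.Injective (monomialClass hΛ) := by
  refine (injective_iff_map_eq_one _).2 fun v hv ↦ ?_
  have h := coaction_of_unitClass_eq hΛ v 1 (by rw [map_one, hv])
  rw [Units.val_one, map_one, MonoidAlgebra.one_def] at h
  exact (MonoidAlgebra.single_left_injective one_ne_zero h).symm

/-- Monomials span the quantum torus. -/
theorem span_monomials (hΛ : Λ.MulAntisymmetric) :
    Submodule.span k {x : QuantumTorus k Λ | ∃ (a : (QuantumTorus k Λ)ˣ) (v : Exponent n),
      unitClass k a = monomialClass hΛ v ∧ x = a} = ⊤ := by
  set s : Set (QuantumTorus k Λ) := {x | ∃ (a : (QuantumTorus k Λ)ˣ) (v : Exponent n),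
      unitClass k a = monomialClass hΛ v ∧ x = a}
  let S : Submonoid (QuantumTorus k Λ) :=
    { carrier := s
      one_mem' := ⟨1, 1, by simp, rfl⟩
      mul_mem' := by
        rintro _ _ ⟨a, v, ha, rfl⟩ ⟨b, w, hb, rfl⟩
        exact ⟨a * b, v * w, by rw [map_mul, map_mul, ha, hb], rfl⟩ }
  have hy : ∀ i, y k Λ i ∈ Algebra.adjoin k s := fun i ↦ Algebra.subset_adjoin
    ⟨unitY k Λ i, basisExponent i, (monomialClass_basisExponent hΛ i).symm, rfl⟩
  have hyinv : ∀ i, yinv k Λ i ∈ Algebra.adjoin k s := fun i ↦ Algebra.subset_adjoin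
    ⟨(unitY k Λ i)⁻¹, (basisExponent i)⁻¹, by
      rw [map_inv, map_inv, monomialClass_basisExponent], rfl⟩
  have h := Algebra.adjoin_eq_span k s
  rw [show Submonoid.closure s = S from Submonoid.closure_eq S,
    subalgebra_eq_top _ hy hyinv] at h
  rw [← Algebra.top_toSubmodule, h]
  rfl

/-- The homogeneous components of an element are multiples of monomials. -/
theorem coeff_coaction (hΛ : Λ.MulAntisymmetric) (x : QuantumTorus k Λ) {v : Exponent n}
    {m : (QuantumTorus k Λ)ˣ} (hm : unitClass k m = monomialClass hΛ v) :
    ∃ c : k, (coaction Λ x).coeff v = c • (m : QuantumTorus k Λ) := by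
  classical
  have hx : x ∈ Submodule.span k _ := (span_monomials hΛ).symm ▸ Submodule.mem_top
  induction hx using Submodule.span_induction with
  | mem x hx =>
    obtain ⟨a, w, ha, rfl⟩ := hx
    rw [coaction_of_unitClass_eq hΛ w a ha, MonoidAlgebra.coeff_single, Finsupp.single_apply]
    split_ifs with h
    · subst h
      obtain ⟨c, hc⟩ := unitClass_eq_iff.1 (hm.trans ha.symm)
      exact ⟨c, hc⟩
    · exact ⟨0, (zero_smul _ _).symm⟩
  | zero => exact ⟨0, by simp⟩
  | add x y _ _ hx hy =>
    obtain ⟨c, hc⟩ := hx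
    obtain ⟨d, hd⟩ := hy
    exact ⟨c + d, by simp [hc, hd, add_smul]⟩
  | smul r x _ hx =>
    obtain ⟨c, hc⟩ := hx
    exact ⟨r * c, by simp [hc, mul_smul]⟩

/-- An element is the sum of its homogeneous components. -/
theorem sum_coeff_coaction (hΛ : Λ.MulAntisymmetric) (x : QuantumTorus k Λ) :
    (coaction Λ x).coeff.sum (fun _ r ↦ r) = x := by
  have hx : x ∈ Submodule.span k _ := (span_monomials hΛ).symm ▸ Submodule.mem_top
  induction hx using Submodule.span_induction with
  | mem x hx =>
    obtain ⟨a, w, ha, rfl⟩ := hx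
    rw [coaction_of_unitClass_eq hΛ w a ha, MonoidAlgebra.coeff_single,
      Finsupp.sum_single_index rfl]
  | zero => simp
  | add x y _ _ hx hy =>
    rw [map_add, MonoidAlgebra.coeff_add,
      Finsupp.sum_add_index' (fun _ ↦ rfl) (fun _ _ _ ↦ rfl), hx, hy]
  | smul r x _ hx =>
    rw [map_smul, MonoidAlgebra.coeff_smul, Finsupp.sum_smul_index' (fun _ ↦ rfl),
      ← Finsupp.smul_sum, hx]

/-- Every unit of a quantum torus is a scalar multiple of a monomial. -/
theorem monomialClass_surjective [Nontrivial (QuantumTorus k Λ)] (hΛ : Λ.MulAntisymmetric) :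
    Function.Surjective (monomialClass hΛ) := by
  intro q
  obtain ⟨a, rfl⟩ := unitClass_surjective q
  have hunit : ∀ (x : QuantumTorus k Λ) (v : Exponent n), (coaction Λ x).coeff v ≠ 0 →
      ∃ m : (QuantumTorus k Λ)ˣ, unitClass k m = monomialClass hΛ v ∧
        (coaction Λ x).coeff v = m := by
    intro x v hv
    obtain ⟨m, hm⟩ := unitClass_surjective (monomialClass hΛ v)
    obtain ⟨c, hc⟩ := coeff_coaction hΛ x hm
    have hc0 : c ≠ 0 := by
      rintro rfl
      exact hv (by rw [hc, zero_smul])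
    refine ⟨Units.mk0 c hc0 • m, ?_, hc⟩
    rw [← hm, eq_comm, unitClass_eq_iff]
    exact ⟨Units.mk0 c hc0, rfl⟩
  set f := coaction Λ (a : QuantumTorus k Λ) with hf
  set g := coaction Λ (↑a⁻¹ : QuantumTorus k Λ) with hg
  have hfg : f * g = MonoidAlgebra.single 1 1 := by
    rw [hf, hg, ← map_mul, Units.mul_inv, map_one, MonoidAlgebra.one_def]
  have hne : ∀ p : Exponent n × Exponent n, p ∈ f.coeff.support ×ˢ g.coeff.support →
      UniqueMul f.coeff.support g.coeff.support p.1 p.2 → p.1 * p.2 = 1 := by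
    intro p hp hu
    obtain ⟨h1, h2⟩ := Finset.mem_product.1 hp
    obtain ⟨m, -, hm⟩ := hunit _ _ (Finsupp.mem_support_iff.1 h1)
    obtain ⟨m', -, hm'⟩ := hunit _ _ (Finsupp.mem_support_iff.1 h2)
    have h := MonoidAlgebra.coeff_mul_mul_of_uniqueMul hu
    by_contra hp1
    rw [hfg, MonoidAlgebra.coeff_single, Finsupp.single_eq_of_ne hp1, hm, hm',
      ← Units.val_mul] at h
    exact (m * m').ne_zero h.symm
  have hcard : f.coeff.support.card * g.coeff.support.card ≤ 1 := by
    by_contra! h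
    obtain ⟨p, hp, q, hq, hpq, hup, huq⟩ := TwoUniqueProds.uniqueMul_of_one_lt_card h
    obtain ⟨h1, h2⟩ := Finset.mem_product.1 hq
    obtain ⟨e1, e2⟩ := hup h1 h2 ((hne q hq huq).trans (hne p hp hup).symm)
    exact hpq (Prod.ext e1.symm e2.symm)
  have hf0 : f.coeff.support.card ≠ 0 := fun h ↦ by
    have := sum_coeff_coaction hΛ (a : QuantumTorus k Λ)
    rw [← hf, Finsupp.sum, Finset.card_eq_zero.1 h, Finset.sum_empty] at this
    exact a.ne_zero this.symm
  have hg0 : g.coeff.support.card ≠ 0 := fun h ↦ by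
    have := sum_coeff_coaction hΛ (↑a⁻¹ : QuantumTorus k Λ)
    rw [← hg, Finsupp.sum, Finset.card_eq_zero.1 h, Finset.sum_empty] at this
    exact (a⁻¹).ne_zero this.symm
  have hf1 : f.coeff.support.card = 1 := by
    have := Nat.le_mul_of_pos_right f.coeff.support.card (Nat.pos_of_ne_zero hg0)
    omega
  obtain ⟨v, hv⟩ := Finset.card_eq_one.1 hf1
  have hsum := sum_coeff_coaction hΛ (a : QuantumTorus k Λ)
  rw [← hf, Finsupp.sum, hv, Finset.sum_singleton] at hsum
  obtain ⟨m, hm, hma⟩ := hunit (a : QuantumTorus k Λ) v (by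
    rw [← hf, hsum]
    exact a.ne_zero)
  refine ⟨v, ?_⟩
  rw [← hm]
  congr 1
  exact Units.ext (by rw [← hma, ← hf, hsum])

theorem unitClass_mul_comm [Nontrivial (QuantumTorus k Λ)] (hΛ : Λ.MulAntisymmetric)
    (p q : UnitsModScalars k (QuantumTorus k Λ)) : p * q = q * p := by
  obtain ⟨v, rfl⟩ := monomialClass_surjective hΛ p
  obtain ⟨w, rfl⟩ := monomialClass_surjective hΛ q
  rw [← map_mul, mul_comm, map_mul]

/-- In a simple quantum torus, a unit commuting with all units is a scalar. -/
theorem unitClass_eq_one_of_commute [IsSimpleRing (QuantumTorus k Λ)] (hΛ : Λ.MulAntisymmetric)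
    (a : (QuantumTorus k Λ)ˣ)
    (ha : ∀ b : (QuantumTorus k Λ)ˣ, (a : QuantumTorus k Λ) * b = b * a) :
    unitClass k a = 1 := by
  have hcenter : ∀ x : QuantumTorus k Λ, x * a = a * x := by
    have h := subalgebra_eq_top (Subalgebra.centralizer k {(a : QuantumTorus k Λ)})
      (fun i ↦ Subalgebra.mem_centralizer_iff k |>.2 fun _ hg ↦ hg ▸ ha (unitY k Λ i))
      (fun i ↦ Subalgebra.mem_centralizer_iff k |>.2 fun _ hg ↦ hg ▸ ha (unitY k Λ i)⁻¹)
    intro x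
    have hx : x ∈ Subalgebra.centralizer k {(a : QuantumTorus k Λ)} := h ▸ trivial
    exact ((Subalgebra.mem_centralizer_iff k).1 hx a rfl).symm
  by_cases h1 : (a : QuantumTorus k Λ) = 1
  · rw [show a = 1 from Units.ext h1, map_one]
  let z : Subring.center (QuantumTorus k Λ) := ⟨(a : QuantumTorus k Λ) - 1,
    Subring.mem_center_iff.2 fun x ↦ by rw [mul_sub, sub_mul, hcenter, mul_one, one_mul]⟩
  have hz : z ≠ 0 := fun h ↦ h1 (sub_eq_zero.1 (congrArg Subtype.val h))
  obtain ⟨w, hw⟩ := (IsSimpleRing.isField_center (QuantumTorus k Λ)).mul_inv_cancel hz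
  have hw' : ((a : QuantumTorus k Λ) - 1) * w = 1 := congrArg Subtype.val hw
  let b : (QuantumTorus k Λ)ˣ := ⟨(a : QuantumTorus k Λ) - 1, w, hw',
    by rw [← Subring.mem_center_iff.1 w.2, hw']⟩
  obtain ⟨v, hv⟩ := monomialClass_surjective hΛ (unitClass k a)
  obtain ⟨u, hu⟩ := monomialClass_surjective hΛ (unitClass k b)
  have hb := coaction_of_unitClass_eq hΛ u b hu.symm
  rw [show (b : QuantumTorus k Λ) = a - 1 from rfl, map_sub, map_one,
    coaction_of_unitClass_eq hΛ v a hv.symm, MonoidAlgebra.one_def] at hb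
  by_cases hv1 : v = 1
  · rw [← hv, hv1, map_one]
  have hcoeff : ∀ t, Finsupp.single v (a : QuantumTorus k Λ) t - Finsupp.single 1 1 t =
      Finsupp.single u ((a : QuantumTorus k Λ) - 1) t := fun t ↦ by
    simpa using congrArg (fun x ↦ x.coeff t) hb
  have hv' := hcoeff v
  have h1' := hcoeff 1
  rw [Finsupp.single_eq_same, Finsupp.single_eq_of_ne hv1, sub_zero] at hv'
  rw [Finsupp.single_eq_same, Finsupp.single_eq_of_ne (Ne.symm hv1),
    zero_sub] at h1'
  by_cases huv : u = v
  · rw [huv, Finsupp.single_eq_of_ne (Ne.symm hv1)] at h1'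
    exact absurd h1' (neg_ne_zero.2 one_ne_zero)
  · rw [Finsupp.single_eq_of_ne (Ne.symm huv)] at hv'
    exact absurd hv' a.ne_zero

/-- An endomorphism of a simple quantum torus is onto on units modulo scalars. -/
theorem map_surjective_of_isSimpleRing [IsSimpleRing (QuantumTorus k Λ)]
    (hΛ : Λ.MulAntisymmetric) (h : QuantumTorus k Λ →ₐ[k] QuantumTorus k Λ) :
    Function.Surjective (UnitsModScalars.map h) := by
  obtain ⟨β, hβ⟩ := exists_commutator_pairing (unitClass_mul_comm hΛ)
  let _ : CommGroup (UnitsModScalars k (QuantumTorus k Λ)) :=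
    { (inferInstance : Group (UnitsModScalars k (QuantumTorus k Λ))) with
      mul_comm := unitClass_mul_comm hΛ }
  have huniq : ∀ (a b : (QuantumTorus k Λ)ˣ) (c : kˣ),
      (a : QuantumTorus k Λ) * b = (c : k) • ((b : QuantumTorus k Λ) * a) →
      β (unitClass k a) (unitClass k b) = c := fun a b c hc ↦ by
    rw [hβ, ← Units.val_mul] at hc
    exact Units.ext (smul_unit_injective (b * a) hc)
  have hmulr : ∀ p q r, β p (q * r) = β p q * β p r := fun p q r ↦ by
    obtain ⟨a, rfl⟩ := unitClass_surjective p
    obtain ⟨b, rfl⟩ := unitClass_surjective q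
    obtain ⟨c, rfl⟩ := unitClass_surjective r
    rw [← map_mul]
    refine huniq _ _ _ ?_
    rw [Units.val_mul, ← mul_assoc, hβ a b, smul_mul_assoc, mul_assoc, hβ a c, mul_smul_comm,
      smul_smul, Units.val_mul, mul_assoc]
  have hmull : ∀ p q r, β (p * q) r = β p r * β q r := fun p q r ↦ by
    obtain ⟨a, rfl⟩ := unitClass_surjective p
    obtain ⟨b, rfl⟩ := unitClass_surjective q
    obtain ⟨c, rfl⟩ := unitClass_surjective r
    rw [← map_mul]
    refine huniq _ _ _ ?_
    rw [Units.val_mul, mul_assoc, hβ b c, mul_smul_comm, ← mul_assoc, hβ a c, smul_mul_assoc,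
      smul_smul, Units.val_mul, mul_assoc, mul_comm (β _ _ : k)]
  let B : Additive (UnitsModScalars k (QuantumTorus k Λ)) →+
      Additive (UnitsModScalars k (QuantumTorus k Λ)) →+ Additive kˣ :=
    AddMonoidHom.mk' (fun p ↦ AddMonoidHom.mk'
      (fun q ↦ Additive.ofMul (β p.toMul q.toMul)) fun q r ↦ hmulr _ _ _)
      fun p q ↦ AddMonoidHom.ext fun r ↦ hmull _ _ _
  let e : (Fin n → ℤ) →+ Additive (UnitsModScalars k (QuantumTorus k Λ)) :=
    (monomialClass hΛ).toAdditive.comp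
      (AddMonoidHom.mk' (fun v ↦ Additive.ofMul fun i ↦ Multiplicative.ofAdd (v i)) fun _ _ ↦ rfl)
  have he : Function.Surjective e := fun q ↦ by
    obtain ⟨v, hv⟩ := monomialClass_surjective hΛ q.toMul
    exact ⟨fun i ↦ (v i).toAdd, hv⟩
  have : Module.Finite ℤ (Additive (UnitsModScalars k (QuantumTorus k Λ))) :=
    Module.Finite.of_surjective e.toIntLinearMap he
  refine surjective_of_preserves_pairing B (fun q hq ↦ ?_)
    (UnitsModScalars.map h).toAdditive.toIntLinearMap fun p q ↦ ?_
  · obtain ⟨b, hb⟩ := unitClass_surjective (k := k) q.toMul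
    refine (show q.toMul = 1 from ?_)
    rw [← hb]
    refine unitClass_eq_one_of_commute hΛ b fun a ↦ ?_
    have h1 : β (unitClass k a) (unitClass k b) = 1 := by
      rw [hb]
      exact hq (Additive.ofMul (unitClass k a))
    rw [hβ a b, h1, Units.val_one, one_smul]
  · obtain ⟨a, ha⟩ := unitClass_surjective (k := k) p.toMul
    obtain ⟨b, hb⟩ := unitClass_surjective (k := k) q.toMul
    change β (UnitsModScalars.map h p.toMul) (UnitsModScalars.map h q.toMul) = β p.toMul q.toMul
    rw [← ha, ← hb, UnitsModScalars.map_unitClass, UnitsModScalars.map_unitClass]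
    refine huniq _ _ _ ?_
    change h a * h b = _ • (h b * h a)
    rw [← map_mul, hβ a b, map_smul, map_mul]

/-- A surjection from the units modulo scalars of a quantum torus to those of another one of the
same rank is injective. -/
theorem injective_of_surjective {Λ' : Matrix (Fin n) (Fin n) k}
    [Nontrivial (QuantumTorus k Λ)] [Nontrivial (QuantumTorus k Λ')]
    (hΛ : Λ.MulAntisymmetric) (hΛ' : Λ'.MulAntisymmetric)
    (φ : UnitsModScalars k (QuantumTorus k Λ') →* UnitsModScalars k (QuantumTorus k Λ))
    (hφ : Function.Surjective φ) : Function.Injective φ := by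
  let e : Exponent n ≃* UnitsModScalars k (QuantumTorus k Λ) :=
    MulEquiv.ofBijective (monomialClass hΛ)
      ⟨monomialClass_injective hΛ, monomialClass_surjective hΛ⟩
  let d : (Fin n → ℤ) ≃+ Additive (Exponent n) :=
    { toFun v := Additive.ofMul fun i ↦ Multiplicative.ofAdd (v i)
      invFun v i := (v.toMul i).toAdd
      map_add' _ _ := rfl }
  let ψ : Exponent n →* Exponent n :=
    (e.symm : _ →* Exponent n).comp (φ.comp (monomialClass hΛ'))
  have hψ : Function.Surjective ψ :=
    e.symm.surjective.comp (hφ.comp (monomialClass_surjective hΛ'))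
  let L : (Fin n → ℤ) →ₗ[ℤ] (Fin n → ℤ) :=
    ((d.symm : Additive (Exponent n) →+ (Fin n → ℤ)).comp
      (ψ.toAdditive.comp (d : (Fin n → ℤ) →+ Additive (Exponent n)))).toIntLinearMap
  have hL : Function.Surjective L := d.symm.surjective.comp (hψ.comp d.surjective)
  have hLinj : Function.Injective L := OrzechProperty.injective_of_surjective_endomorphism L hL
  have hψinj : Function.Injective ψ := fun v w hvw ↦ by
    have : L (d.symm v) = L (d.symm w) := congrArg d.symm hvw
    exact d.symm.injective (hLinj this)
  intro p q hpq
  obtain ⟨v, rfl⟩ := monomialClass_surjective hΛ' p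
  obtain ⟨w, rfl⟩ := monomialClass_surjective hΛ' q
  rw [hψinj (congrArg e.symm hpq : ψ v = ψ w)]

/-- An algebra homomorphism to a quantum torus which is onto on units modulo scalars is onto. -/
theorem surjective_of_map_surjective {R : Type*} [Ring R] [Algebra k R]
    (f : R →ₐ[k] QuantumTorus k Λ) (hf : Function.Surjective (UnitsModScalars.map f)) :
    Function.Surjective f := by
  have hunit : ∀ b : (QuantumTorus k Λ)ˣ, (b : QuantumTorus k Λ) ∈ f.range := fun b ↦ by
    obtain ⟨q, hq⟩ := hf (unitClass k b)
    obtain ⟨a, rfl⟩ := unitClass_surjective q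
    rw [UnitsModScalars.map_unitClass, unitClass_eq_iff] at hq
    obtain ⟨c, hc⟩ := hq
    exact ⟨(c : k) • (a : R), by rw [hc]; exact map_smul f _ _⟩
  exact AlgHom.range_eq_top f |>.1
    (subalgebra_eq_top _ (fun i ↦ hunit (unitY k Λ i)) fun i ↦ hunit (unitY k Λ i)⁻¹)

end QuantumTorus

/-- If `O_Λ((k*)^n)` is a maximal quantum subtorus of `A`,
`O_{Λ'}((k*)^n)` is a maximal quantum subtorus of `B`, `A ≅ B` as `k`-algebras and
`O_Λ((k*)^n)` is simple, then `O_Λ((k*)^n) ≅ O_{Λ'}((k*)^n)`. -/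
theorem stmt9 {k : Type u} [Field k] [CharZero k] {n : ℕ} (hn : 1 ≤ n)
    (Λ Λ' : Matrix (Fin n) (Fin n) k) (hΛ : Λ.MulAntisymmetric) (hΛ' : Λ'.MulAntisymmetric)
    (A B : Type u) [Ring A] [Algebra k A] [Ring B] [Algebra k B]
    (hA : IsMaxQuantumSubtorus k Λ A) (hB : IsMaxQuantumSubtorus k Λ' B)
    (hAB : Nonempty (A ≃ₐ[k] B)) (hsimple : IsSimpleRing (QuantumTorus k Λ)) :
    Nonempty (QuantumTorus k Λ ≃ₐ[k] QuantumTorus k Λ') := by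
  obtain ⟨φ⟩ := hAB
  obtain ⟨f₀, -⟩ := hA.1
  obtain ⟨g₀, -⟩ := hB.1
  obtain ⟨f⟩ := hB.2 n hn Λ hΛ ⟨(φ : A →ₐ[k] B).comp f₀⟩
  obtain ⟨g⟩ := hA.2 n hn Λ' hΛ' ⟨(φ.symm : B →ₐ[k] A).comp g₀⟩
  have : Nontrivial (QuantumTorus k Λ') :=
    (g : QuantumTorus k Λ' →+* QuantumTorus k Λ).domain_nontrivial
  have hgf : Function.Surjective (UnitsModScalars.map g ∘ UnitsModScalars.map f) := by
    convert QuantumTorus.map_surjective_of_isSimpleRing hΛ (g.comp f) using 1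
    funext q
    obtain ⟨a, rfl⟩ := unitClass_surjective q
    rfl
  have hg : Function.Injective (UnitsModScalars.map g) :=
    QuantumTorus.injective_of_surjective hΛ hΛ' _ hgf.of_comp
  have hf : Function.Surjective (UnitsModScalars.map f) := fun q ↦ by
    obtain ⟨p, hp⟩ := hgf (UnitsModScalars.map g q)
    exact ⟨p, hg hp⟩
  exact ⟨AlgEquiv.ofBijective f ⟨(f : QuantumTorus k Λ →+* QuantumTorus k Λ').injective,
    QuantumTorus.surjective_of_map_surjective f hf⟩⟩
end

section
/- Let n, n' ≥ 1, let Λ ∈ M_n(k*) and Λ' ∈ M_{n'}(k*) be multiplicatively antisymmetric, and let A and B be k-algebras. Suppose O_Λ((k*)^n) is a maximal quantum subtorus of A and is a simple ring, and O_{Λ'}((k*)^{n'}) is а maximal quantum subtorus of B and is a simple ring. If A and B are isomorphic as k-algebras, then n = n' and the quantum tori O_Λ((k*)^n) and O_{Λ'}((k*)^{n'}) are isomorphic as k-algebras. In particular (taking A = B), a maximal quantum subtorus of a k-algebra that is a simple ring is unique up to k-algebra isomorphism. -/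
universe u

/-- An isometry of a nondegenerate biadditive pairing on a finitely generated abelian group is
surjective. -/
theorem LinearMap.surjective_of_isometry_of_nondegenerate {M N : Type*} [AddCommGroup M]
    [Module.Finite ℤ M] [AddCommGroup N] (β : M →ₗ[ℤ] M →ₗ[ℤ] N)
    (hβ : ∀ v, (∀ u, β u v = 0) → v = 0) (Γ : M →ₗ[ℤ] M)
    (hΓ : ∀ u v, β (Γ u) (Γ v) = β u v) : Function.Surjective Γ := by
  obtain ⟨p, hp, hpΓ⟩ := LinearMap.exists_monic_and_aeval_eq_zero ℤ Γ
  have hpow : ∀ (i : ℕ) u v, β ((Γ ^ i) u) ((Γ ^ i) v) = β u v := by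
    intro i
    induction i with
    | zero => simp
    | succ i ih => intro u v; rw [pow_succ, Module.End.mul_apply, Module.End.mul_apply, ih, hΓ]
  intro v
  have key : ∑ i ∈ Finset.range (p.natDegree + 1), p.coeff i • (Γ ^ (p.natDegree - i)) v = 0 := by
    apply hβ
    intro u
    have h : β (Polynomial.aeval Γ p u) ((Γ ^ p.natDegree) v) = 0 := by simp [hpΓ]
    rw [Polynomial.aeval_eq_sum_range] at h
    rw [← h, map_sum, LinearMap.sum_apply, map_sum, LinearMap.sum_apply]
    refine Finset.sum_congr rfl fun i hi => ?_
    have hi' : i ≤ p.natDegree := by simpa [Nat.lt_succ_iff] using hi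
    rw [LinearMap.smul_apply, map_smul, map_smul, LinearMap.smul_apply]
    conv_rhs => rw [← Nat.add_sub_cancel' hi', pow_add, Module.End.mul_apply, hpow]
  rw [Finset.sum_range_succ, hp.coeff_natDegree] at key
  refine ⟨-∑ i ∈ Finset.range p.natDegree, p.coeff i • (Γ ^ (p.natDegree - i - 1)) v, ?_⟩
  rw [map_neg, map_sum, neg_eq_iff_add_eq_zero, ← key]
  congr 1
  · refine Finset.sum_congr rfl fun i hi => ?_
    have hi' : p.natDegree - i = (p.natDegree - i - 1) + 1 := by
      have := Finset.mem_range.1 hi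
      omega
    rw [map_smul]
    conv_rhs => rw [hi', pow_succ', Module.End.mul_apply]
  · simp

/-- A `k`-basis of `R` indexed by an abelian group, multiplicative up to a bicharacter. -/
structure TwistedBasis (k : Type*) [Field k] (G R : Type*) [AddCommGroup G] [Ring R]
    [Algebra k R] where
  basis : Module.Basis G k R
  cocycle : G →ₗ[ℤ] G →ₗ[ℤ] Additive kˣ
  mul_eq : ∀ u v, basis u * basis v = ((cocycle u v).toMul : k) • basis (u + v)
  zero_eq : basis 0 = 1

namespace TwistedBasis

variable {k : Type*} [Field k] {G G' R R' : Type*} [AddCommGroup G] [AddCommGroup G']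
  [Ring R] [Ring R'] [Algebra k R] [Algebra k R']

/-- The commutation bicharacter. -/
def comm (X : TwistedBasis k G R) : G →ₗ[ℤ] G →ₗ[ℤ] Additive kˣ :=
  X.cocycle - X.cocycle.flip

theorem mul_comm_eq (X : TwistedBasis k G R) (u v : G) :
    X.basis u * X.basis v = ((X.comm u v).toMul : k) • (X.basis v * X.basis u) := by
  rw [X.mul_eq, X.mul_eq, smul_smul, add_comm v u]
  congr 1
  simp [comm]

theorem smul_basis_inj (X : TwistedBasis k G R) {a b : k} {u v : G} (ha : a ≠ 0)
    (h : a • X.basis u = b • X.basis v) : u = v ∧ a = b := by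
  have h' := congrArg X.basis.repr h
  simp only [map_smul, Module.Basis.repr_self, Finsupp.smul_single, smul_eq_mul, mul_one] at h'
  rcases (Finsupp.single_eq_single_iff _ _ _ _).1 h' with h | h
  · exact h
  · exact absurd h.1 ha

theorem repr_mul_of_uniqueAdd (X : TwistedBasis k G R) (f g : R) {u v : G}
    (h : UniqueAdd (X.basis.repr f).support (X.basis.repr g).support u v) :
    X.basis.repr (f * g) (u + v) =
      X.basis.repr f u * X.basis.repr g v * ((X.cocycle u v).toMul : k) := by
  classical
  conv_lhs => rw [← X.basis.linearCombination_repr f, ← X.basis.linearCombination_repr g]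
  simp only [Finsupp.linearCombination_apply, Finsupp.sum, Finset.sum_mul_sum, smul_mul_smul_comm,
    X.mul_eq, smul_smul, map_sum, map_smul, Module.Basis.repr_self, Finsupp.coe_finsetSum,
    Finset.sum_apply, Finsupp.smul_single, smul_eq_mul, mul_one, Finsupp.single_apply]
  rw [Finset.sum_eq_single u, Finset.sum_eq_single v]
  · simp
  · intro w hw hwv
    by_cases hu : X.basis.repr f u = 0
    · simp [hu]
    rw [if_neg]
    intro he
    exact hwv (h (Finsupp.mem_support_iff.2 hu) hw he).2
  · intro hv
    simp [Finsupp.notMem_support_iff.1 hv]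
  · intro w hw hwu
    refine Finset.sum_eq_zero fun x hx => ?_
    rw [if_neg]
    intro he
    exact hwu (h hw hx he).1
  · intro hu
    simp [Finsupp.notMem_support_iff.1 hu]

theorem exists_eq_smul_of_isUnit [TwoUniqueSums G] (X : TwistedBasis k G R) {f : R}
    (hf : IsUnit f) : ∃ a : k, a ≠ 0 ∧ ∃ v, f = a • X.basis v := by
  classical
  have : Nontrivial R := ⟨⟨X.basis 0, 0, X.basis.ne_zero 0⟩⟩
  obtain ⟨g, hfg, -⟩ := isUnit_iff_exists.1 hf
  have hf0 : f ≠ 0 := hf.ne_zero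
  have hg0 : g ≠ 0 := by rintro rfl; simp at hfg
  have hAf : (X.basis.repr f).support.Nonempty := by simpa using hf0
  have hAg : (X.basis.repr g).support.Nonempty := by simpa using hg0
  have hcard : (X.basis.repr f).support.card * (X.basis.repr g).support.card ≤ 1 := by
    by_contra! hlt
    obtain ⟨p, hp, q, hq, hpq, hup, huq⟩ := TwoUniqueSums.uniqueAdd_of_one_lt_card hlt
    rw [Finset.mem_product] at hp hq
    have aux : ∀ p : G × G, p.1 ∈ (X.basis.repr f).support → p.2 ∈ (X.basis.repr g).support →
        UniqueAdd (X.basis.repr f).support (X.basis.repr g).support p.1 p.2 → p.1 + p.2 = 0 := by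
      intro p h1 h2 h
      have h3 := X.repr_mul_of_uniqueAdd f g h
      by_contra hne
      rw [hfg, ← X.zero_eq, Module.Basis.repr_self, Finsupp.single_apply,
        if_neg (Ne.symm hne)] at h3
      rw [Finsupp.mem_support_iff] at h1 h2
      exact mul_ne_zero (mul_ne_zero h1 h2) (Units.ne_zero _) h3.symm
    have h4 := hup hq.1 hq.2 ((aux q hq.1 hq.2 huq).trans (aux p hp.1 hp.2 hup).symm)
    exact hpq (Prod.ext h4.1.symm h4.2.symm)
  have h1 : (X.basis.repr f).support.card = 1 := by
    have := hAf.card_pos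
    have := hAg.card_pos
    nlinarith
  obtain ⟨v, a, ha, hv⟩ := Finsupp.card_support_eq_one'.1 h1
  exact ⟨a, ha, v, by rw [← X.basis.repr.symm_apply_apply f, hv]; simp⟩

theorem isUnit_basis (X : TwistedBasis k G R) (u : G) : IsUnit (X.basis u) := by
  refine isUnit_iff_exists_and_exists.2
    ⟨⟨(((X.cocycle u (-u)).toMul⁻¹ : kˣ) : k) • X.basis (-u), ?_⟩,
      ⟨(((X.cocycle (-u) u).toMul⁻¹ : kˣ) : k) • X.basis (-u), ?_⟩⟩
  · rw [mul_smul_comm, X.mul_eq, smul_smul, add_neg_cancel, X.zero_eq, Units.inv_mul, one_smul]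
  · rw [smul_mul_assoc, X.mul_eq, smul_smul, neg_add_cancel, X.zero_eq, Units.inv_mul, one_smul]

theorem eq_zero_of_comm_eq_zero [TwoUniqueSums G] [IsSimpleRing R] (X : TwistedBasis k G R)
    {v : G} (h : ∀ u, X.comm u v = 0) : v = 0 := by
  by_contra hv
  have hcomm : ∀ r, r * X.basis v = X.basis v * r := by
    intro r
    have hr := X.basis.mem_span r
    induction hr using Submodule.span_induction with
    | mem x hx =>
      obtain ⟨u, rfl⟩ := hx
      rw [X.mul_comm_eq, h u]
      simp
    | zero => simp
    | add x y _ _ hx hy => rw [add_mul, mul_add, hx, hy]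
    | smul a x _ hx => rw [smul_mul_assoc, mul_smul_comm, hx]
  let z : Subring.center R :=
    ⟨X.basis v - 1, Subring.mem_center_iff.2 fun r => by rw [mul_sub, sub_mul, hcomm]; simp⟩
  have hz : z ≠ 0 := by
    intro hz
    have h1 : X.basis v - 1 = 0 := congrArg Subtype.val hz
    rw [sub_eq_zero, ← X.zero_eq] at h1
    exact hv (X.basis.injective h1)
  obtain ⟨w, hw⟩ := (IsSimpleRing.isField_center R).mul_inv_cancel hz
  have hunit : IsUnit (X.basis v - 1) :=
    (IsUnit.of_mul_eq_one w hw : IsUnit z).map (Subring.center R).subtype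
  obtain ⟨a, ha, w, h1⟩ := X.exists_eq_smul_of_isUnit hunit
  rw [← X.zero_eq] at h1
  have h2 := congrArg X.basis.repr h1
  simp only [map_sub, map_smul, Module.Basis.repr_self, Finsupp.smul_single, smul_eq_mul,
    mul_one] at h2
  have hv' : v = w := by
    by_contra hvw
    have h3 := DFunLike.congr_fun h2 v
    simp [Ne.symm hv, Ne.symm hvw] at h3
  have h0' : 0 = w := by
    by_contra h0w
    have h3 := DFunLike.congr_fun h2 0
    simp [hv, Ne.symm h0w] at h3
  exact hv (hv'.trans h0'.symm)

theorem exists_linearMap [TwoUniqueSums G] (X' : TwistedBasis k G' R') (X : TwistedBasis k G R)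
    (φ : R' →ₐ[k] R) : ∃ Φ : G' →ₗ[ℤ] G,
      (∀ u, ∃ a : k, a ≠ 0 ∧ φ (X'.basis u) = a • X.basis (Φ u)) ∧
      ∀ u v, X.comm (Φ u) (Φ v) = X'.comm u v := by
  have H : ∀ u, ∃ w, ∃ a : k, a ≠ 0 ∧ φ (X'.basis u) = a • X.basis w := by
    intro u
    obtain ⟨a, ha, w, h⟩ := X.exists_eq_smul_of_isUnit ((X'.isUnit_basis u).map φ)
    exact ⟨w, a, ha, h⟩
  choose Φ a ha hΦ using H
  have hadd : ∀ u v, Φ (u + v) = Φ u + Φ v := by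
    intro u v
    have h1 := congrArg φ (X'.mul_eq u v)
    rw [map_mul, map_smul, hΦ, hΦ, hΦ, smul_mul_smul_comm, X.mul_eq, smul_smul, smul_smul] at h1
    exact (X.smul_basis_inj (mul_ne_zero (mul_ne_zero (ha u) (ha v)) (Units.ne_zero _)) h1).1.symm
  refine ⟨(AddMonoidHom.mk' Φ hadd).toIntLinearMap, fun u => ⟨a u, ha u, hΦ u⟩, fun u v => ?_⟩
  have h1 := congrArg φ (X'.mul_comm_eq u v)
  rw [map_smul, map_mul, map_mul, hΦ, hΦ, smul_mul_smul_comm, smul_mul_smul_comm,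
    X.mul_comm_eq, smul_smul, smul_smul, X.mul_eq, smul_smul, smul_smul] at h1
  have h2 := (X.smul_basis_inj (mul_ne_zero (mul_ne_zero (mul_ne_zero (ha u) (ha v))
    (Units.ne_zero _)) (Units.ne_zero _)) h1).2
  have h3 := mul_right_cancel₀ (Units.ne_zero _) h2
  rw [mul_comm (a v) (a u), mul_comm] at h3
  exact Additive.toMul.injective
    (Units.ext (mul_right_cancel₀ (mul_ne_zero (ha u) (ha v)) h3))

/-- Homomorphisms in both directions between simple algebras with twisted bases indexed by finitely
generated groups are isomorphisms. -/
theorem bijective_of_algHom [TwoUniqueSums G] [TwoUniqueSums G'] [Module.Finite ℤ G]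
    [IsSimpleRing R] [IsSimpleRing R'] (X' : TwistedBasis k G' R') (X : TwistedBasis k G R)
    (φ : R' →ₐ[k] R) (ψ : R →ₐ[k] R') :
    Function.Bijective φ ∧ Nonempty (G' ≃ₗ[ℤ] G) := by
  obtain ⟨Φ, hΦ, hΦc⟩ := X'.exists_linearMap X φ
  obtain ⟨Ψ, -, hΨc⟩ := X.exists_linearMap X' ψ
  have hsurj : Function.Surjective Φ := by
    have h := LinearMap.surjective_of_isometry_of_nondegenerate X.comm
      (fun v => X.eq_zero_of_comm_eq_zero) (Φ ∘ₗ Ψ) (fun u v => by simp [hΦc, hΨc])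
    rw [LinearMap.coe_comp] at h
    exact h.of_comp
  have hinj : Function.Injective Φ := by
    rw [injective_iff_map_eq_zero]
    intro v hv
    refine X'.eq_zero_of_comm_eq_zero fun u => ?_
    rw [← hΦc, hv, map_zero]
  refine ⟨⟨RingHom.injective (φ : R' →+* R), ?_⟩, ⟨LinearEquiv.ofBijective Φ ⟨hinj, hsurj⟩⟩⟩
  have h : ⊤ ≤ LinearMap.range φ.toLinearMap := by
    rw [← X.basis.span_eq, Submodule.span_le]
    rintro _ ⟨w, rfl⟩
    obtain ⟨u, rfl⟩ := hsurj w
    obtain ⟨a, ha, h⟩ := hΦ u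
    exact ⟨a⁻¹ • X'.basis u, by simp [h, smul_smul, ha]⟩
  exact fun r => h (Submodule.mem_top (x := r))

/-- The operator `e_w ↦ c(v, w) e_{v + w}`. -/
noncomputable def shift (c : G →ₗ[ℤ] G →ₗ[ℤ] Additive kˣ) (v : G) : Module.End k (G →₀ k) :=
  Finsupp.linearCombination k fun w => Finsupp.single (v + w) ((c v w).toMul : k)

theorem shift_single (c : G →ₗ[ℤ] G →ₗ[ℤ] Additive kˣ) (v w : G) (a : k) :
    shift c v (Finsupp.single w a) = Finsupp.single (v + w) (a * ((c v w).toMul : k)) := by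
  simp [shift]

theorem shift_mul (c : G →ₗ[ℤ] G →ₗ[ℤ] Additive kˣ) (u v : G) :
    shift c u * shift c v = ((c u v).toMul : k) • shift c (u + v) := by
  refine Finsupp.lhom_ext' fun w => LinearMap.ext_ring ?_
  simp only [LinearMap.comp_apply, Finsupp.lsingle_apply, Module.End.mul_apply,
    LinearMap.smul_apply, shift_single, Finsupp.smul_single, smul_eq_mul, map_add,
    LinearMap.add_apply, toMul_add, Units.val_mul, add_assoc]
  congr 1
  ring

theorem shift_zero (c : G →ₗ[ℤ] G →ₗ[ℤ] Additive kˣ) : shift c 0 = 1 := by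
  refine Finsupp.lhom_ext' fun w => LinearMap.ext_ring ?_
  simp [shift_single]

theorem linearIndependent_shift (c : G →ₗ[ℤ] G →ₗ[ℤ] Additive kˣ) :
    LinearIndependent k (shift c) := by
  refine LinearIndependent.of_comp (LinearMap.applyₗ (Finsupp.single 0 1)) ?_
  have h : LinearMap.applyₗ (Finsupp.single 0 1) ∘ shift c = fun v => Finsupp.single v (1 : k) := by
    ext1 v
    simp [shift_single]
  rw [h]
  exact Finsupp.linearIndependent_single_one k G

theorem span_shift_mul_mem (c : G →ₗ[ℤ] G →ₗ[ℤ] Additive kˣ) {x y : Module.End k (G →₀ k)}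
    (hx : x ∈ Submodule.span k (Set.range (shift c)))
    (hy : y ∈ Submodule.span k (Set.range (shift c))) :
    x * y ∈ Submodule.span k (Set.range (shift c)) := by
  have h := Submodule.mul_mem_mul hx hy
  rw [Submodule.span_mul_span] at h
  refine Submodule.span_le.2 ?_ h
  rintro _ ⟨_, ⟨u, rfl⟩, _, ⟨v, rfl⟩, rfl⟩
  change shift c u * shift c v ∈ _
  rw [shift_mul]
  exact Submodule.smul_mem _ _ (Submodule.subset_span ⟨_, rfl⟩)

/-- A faithful representation with image spanned by the shift operators gives a twisted basis. -/
theorem nonempty_of_injective (c : G →ₗ[ℤ] G →ₗ[ℤ] Additive kˣ)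
    (ρ : R →ₐ[k] Module.End k (G →₀ k)) (hρ : Function.Injective ρ)
    (hspan : ∀ r, ρ r ∈ Submodule.span k (Set.range (shift c)))
    (hshift : ∀ v, ∃ r, ρ r = shift c v) : Nonempty (TwistedBasis k G R) := by
  choose x hx using hshift
  have hcomp : ρ.toLinearMap ∘ x = shift c := funext hx
  have hli : LinearIndependent k x := by
    refine LinearIndependent.of_comp ρ.toLinearMap ?_
    rw [hcomp]
    exact linearIndependent_shift c
  have htop : ⊤ ≤ Submodule.span k (Set.range x) := by
    intro r _
    have h := hspan r
    rw [← hcomp, Set.range_comp, Submodule.span_image] at h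
    obtain ⟨s, hs, hsr⟩ := h
    rwa [← hρ hsr]
  refine ⟨⟨Module.Basis.mk hli htop, c, fun u v => ?_, ?_⟩⟩
  · simp only [Module.Basis.mk_apply]
    apply hρ
    rw [map_mul, map_smul, hx, hx, hx, shift_mul]
  · rw [Module.Basis.mk_apply]
    apply hρ
    rw [map_one, hx, shift_zero]

end TwistedBasis

namespace QuantumTorus

variable {k : Type u} [Field k] {n : ℕ} {Λ : Matrix (Fin n) (Fin n) k}

/-- The lower triangular part of a multiplicatively antisymmetric matrix. -/
noncomputable def lowerUnits (hΛ : Λ.MulAntisymmetric) (i j : Fin n) : kˣ :=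
  if j < i then Units.mkOfMulEqOne _ _ (hΛ.2 i j) else 1

/-- The bicharacter `(u, v) ↦ ∏_{j < i} Λ_{i,j} ^ (u_i v_j)`. -/
noncomputable def cocycle (hΛ : Λ.MulAntisymmetric) :
    (Fin n → ℤ) →ₗ[ℤ] (Fin n → ℤ) →ₗ[ℤ] Additive kˣ :=
  LinearMap.mk₂ ℤ (fun u v => ∑ i, ∑ j, (u i * v j) • Additive.ofMul (lowerUnits hΛ i j))
    (fun u u' v => by simp only [Pi.add_apply, add_mul, add_zsmul, Finset.sum_add_distrib])
    (fun a u v => by simp [Finset.smul_sum, smul_smul, mul_assoc])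
    (fun u v v' => by simp only [Pi.add_apply, mul_add, add_zsmul, Finset.sum_add_distrib])
    (fun a u v => by simp [Finset.smul_sum, smul_smul, mul_left_comm])

theorem cocycle_single (hΛ : Λ.MulAntisymmetric) (i j : Fin n) :
    cocycle hΛ (Pi.single i 1) (Pi.single j 1) = Additive.ofMul (lowerUnits hΛ i j) := by
  rw [cocycle, LinearMap.mk₂_apply, Finset.sum_eq_single i, Finset.sum_eq_single j]
  · simp
  · intro b _ hb
    simp [hb]
  · simp
  · intro b _ hb
    simp [hb]
  · simp

theorem lowerUnits_eq (hΛ : Λ.MulAntisymmetric) (i j : Fin n) :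
    (lowerUnits hΛ i j : k) = Λ i j * lowerUnits hΛ j i := by
  rcases lt_trichotomy i j with h | rfl | h
  · simp [lowerUnits, h, h.not_gt, hΛ.2]
  · simp [lowerUnits, hΛ.1]
  · simp [lowerUnits, h, h.not_gt]

/-- The images of the generators under the representation by shift operators. -/
noncomputable def genShift (hΛ : Λ.MulAntisymmetric) :
    Fin n ⊕ Fin n → Module.End k ((Fin n → ℤ) →₀ k) :=
  Sum.elim (fun i => TwistedBasis.shift (cocycle hΛ) (Pi.single i 1))
    (fun i => TwistedBasis.shift (cocycle hΛ) (-Pi.single i 1))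

theorem cocycle_single_self (hΛ : Λ.MulAntisymmetric) (i : Fin n) :
    cocycle hΛ (Pi.single i 1) (Pi.single i 1) = 0 := by
  simp [cocycle_single, lowerUnits]

/-- The representation of the quantum torus by shift operators. -/
noncomputable def rep (hΛ : Λ.MulAntisymmetric) :
    QuantumTorus k Λ →ₐ[k] Module.End k ((Fin n → ℤ) →₀ k) :=
  RingQuot.liftAlgHom k ⟨FreeAlgebra.lift k (genShift hΛ), by
    rintro _ _ (⟨i, j⟩ | i | i)
    · simp only [map_mul, FreeAlgebra.lift_ι_apply, AlgHom.commutes, genShift, Sum.elim_inl,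
        TwistedBasis.shift_mul, cocycle_single, toMul_ofMul]
      rw [lowerUnits_eq, add_comm, mul_smul, Algebra.algebraMap_eq_smul_one, smul_mul_assoc,
        one_mul]
    · simp [genShift, TwistedBasis.shift_mul, cocycle_single_self, TwistedBasis.shift_zero]
    · simp [genShift, TwistedBasis.shift_mul, cocycle_single_self, TwistedBasis.shift_zero]⟩

theorem rep_mk (hΛ : Λ.MulAntisymmetric) (x : FreeAlgebra k (Fin n ⊕ Fin n)) :
    rep hΛ (RingQuot.mkAlgHom k (QTorusRel k Λ) x : RingQuot (QTorusRel k Λ)) =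
      FreeAlgebra.lift k (genShift hΛ) x :=
  RingQuot.liftAlgHom_mkAlgHom_apply _ _ _ _

theorem rep_mem_span (hΛ : Λ.MulAntisymmetric) (r : QuantumTorus k Λ) :
    rep hΛ r ∈ Submodule.span k (Set.range (TwistedBasis.shift (cocycle hΛ))) := by
  obtain ⟨x, rfl⟩ := RingQuot.mkAlgHom_surjective k (QTorusRel k Λ) r
  rw [rep_mk]
  induction x using FreeAlgebra.induction with
  | grade0 a =>
    rw [AlgHom.commutes, Algebra.algebraMap_eq_smul_one, ← TwistedBasis.shift_zero (cocycle hΛ)]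
    exact Submodule.smul_mem _ _ (Submodule.subset_span ⟨_, rfl⟩)
  | grade1 i =>
    rw [FreeAlgebra.lift_ι_apply]
    rcases i with i | i <;> exact Submodule.subset_span ⟨_, rfl⟩
  | mul x y hx hy => rw [map_mul]; exact TwistedBasis.span_shift_mul_mem _ hx hy
  | add x y hx hy => rw [map_add]; exact add_mem hx hy

theorem exists_rep_eq_shift (hΛ : Λ.MulAntisymmetric) (v : Fin n → ℤ) :
    ∃ r, rep hΛ r = TwistedBasis.shift (cocycle hΛ) v := by
  have hadd : ∀ u v, TwistedBasis.shift (cocycle hΛ) u ∈ (rep hΛ).range →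
      TwistedBasis.shift (cocycle hΛ) v ∈ (rep hΛ).range →
      TwistedBasis.shift (cocycle hΛ) (u + v) ∈ (rep hΛ).range := by
    intro u v hu hv
    have h := Subalgebra.smul_mem _ (mul_mem hu hv) (((cocycle hΛ u v).toMul⁻¹ : kˣ) : k)
    rwa [TwistedBasis.shift_mul, smul_smul, Units.inv_mul, one_smul] at h
  let S : AddSubgroup (Fin n → ℤ) :=
    { carrier := {v | TwistedBasis.shift (cocycle hΛ) v ∈ (rep hΛ).range ∧
        TwistedBasis.shift (cocycle hΛ) (-v) ∈ (rep hΛ).range}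
      zero_mem' := by
        rw [Set.mem_ofPred_eq, neg_zero, TwistedBasis.shift_zero]
        exact ⟨one_mem _, one_mem _⟩
      add_mem' := fun {u v} hu hv =>
        ⟨hadd u v hu.1 hv.1, by rw [neg_add]; exact hadd _ _ hu.2 hv.2⟩
      neg_mem' := fun {v} hv => ⟨hv.2, by rw [neg_neg]; exact hv.1⟩ }
  have hgen : ∀ i, Pi.single i 1 ∈ S := fun i =>
    ⟨⟨y k Λ i, (rep_mk hΛ _).trans (FreeAlgebra.lift_ι_apply _ _)⟩,
      ⟨yinv k Λ i, (rep_mk hΛ _).trans (FreeAlgebra.lift_ι_apply _ _)⟩⟩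
  have hv : v ∈ S := by
    rw [← Finset.univ_sum_single v]
    refine sum_mem fun i _ => ?_
    have h := S.zsmul_mem (hgen i) (v i)
    rwa [← Pi.single_smul, smul_eq_mul, mul_one] at h
  exact hv.1

theorem nonempty_twistedBasis (hΛ : Λ.MulAntisymmetric) [IsSimpleRing (QuantumTorus k Λ)] :
    Nonempty (TwistedBasis k (Fin n → ℤ) (QuantumTorus k Λ)) :=
  TwistedBasis.nonempty_of_injective (cocycle hΛ) (rep hΛ)
    (RingHom.injective (rep hΛ : QuantumTorus k Λ →+* Module.End k ((Fin n → ℤ) →₀ k)))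
    (rep_mem_span hΛ) (exists_rep_eq_shift hΛ)

end QuantumTorus

/-- If `O_Λ((k*)^n)` is a simple maximal quantum subtorus of `A`,
`O_{Λ'}((k*)^{n'})` is a simple maximal quantum subtorus of `B`, and `A ≅ B` as
`k`-algebras, then `n = n'` and `O_Λ((k*)^n) ≅ O_{Λ'}((k*)^{n'})`. -/
theorem stmt10 {k : Type u} [Field k] [CharZero k] {n n' : ℕ} (hn : 1 ≤ n) (hn' : 1 ≤ n')
    (Λ : Matrix (Fin n) (Fin n) k) (hΛ : Λ.MulAntisymmetric)
    (Λ' : Matrix (Fin n') (Fin n') k) (hΛ' : Λ'.MulAntisymmetric)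
    (A B : Type u) [Ring A] [Algebra k A] [Ring B] [Algebra k B]
    (hA : IsMaxQuantumSubtorus k Λ A) (hAsimple : IsSimpleRing (QuantumTorus k Λ))
    (hB : IsMaxQuantumSubtorus k Λ' B) (hBsimple : IsSimpleRing (QuantumTorus k Λ'))
    (hAB : Nonempty (A ≃ₐ[k] B)) :
    n = n' ∧ Nonempty (QuantumTorus k Λ ≃ₐ[k] QuantumTorus k Λ') := by
  obtain ⟨e⟩ := hAB
  obtain ⟨f, -⟩ := hA.1
  obtain ⟨g, -⟩ := hB.1
  obtain ⟨φ⟩ := hB.2 n hn Λ hΛ ⟨(e : A →ₐ[k] B).comp f⟩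
  obtain ⟨ψ⟩ := hA.2 n' hn' Λ' hΛ' ⟨(e.symm : B →ₐ[k] A).comp g⟩
  obtain ⟨X⟩ := QuantumTorus.nonempty_twistedBasis hΛ
  obtain ⟨X'⟩ := QuantumTorus.nonempty_twistedBasis hΛ'
  obtain ⟨hφ, ⟨E⟩⟩ := X.bijective_of_algHom X' φ ψ
  exact ⟨by simpa using E.finrank_eq, ⟨AlgEquiv.ofBijective φ hφ⟩⟩
end
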